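/- There do not exist differentiable functions X, Y : ℝ → ℝ satisfying X′(s) = P₁(X(s), Y(s)) and Y′(s) = Q₁(X(s), Y(s)) for all s ≥ 0, such that 0 < X(s) < 1, Y(s) > 0 and Y′(s) > 0 for all s ≥ 0, and such that Y is unbounded on [0, ∞). -/

import Mathlib

/-- Right-hand side `P_ε(X,Y)` of the rescaled Laplacian coflow equation for `X`. -/
noncomputable def coflowP (ε X Y : ℝ) : ℝ :=
  (4 / X ^ 2) *
    ((X + 1) * Y ^ 2 + 2 * ε * (2 * X ^ 2 - 2 * X - 1) * X * Y
      - 2 * X ^ 2 * (2 * X - 1) * (X + 1))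

/-- Right-hand side `Q_ε(X,Y)` of the rescaled Laplacian coflow equation for `Y`. -/
noncomputable def coflowQ (ε X Y : ℝ) : ℝ :=
  (4 * Y / X ^ 2) *
    (2 * (1 - X) * Y ^ 2 + ε * (2 * X ^ 2 - 3 * X - 1) * Y + 2 * X * (1 - 2 * X))

/-- On the strip `0 < X < 1`, the `X`-component of the field is at least `1` once `Y ≥ 5`. -/
theorem one_le_coflowP {X Y : ℝ} (hX₀ : 0 < X) (hX₁ : X < 1) (hY : 5 ≤ Y) :
    1 ≤ coflowP 1 X Y := by
  have hcoef : -3 ≤ 2 * (2 * X ^ 2 - 2 * X - 1) * X := by nlinarith [sq_nonneg (2 * X - 1)]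
  have hlin : -3 * Y ≤ 2 * (2 * X ^ 2 - 2 * X - 1) * X * Y :=
    mul_le_mul_of_nonneg_right hcoef (by linarith)
  have hquad : Y ^ 2 ≤ (X + 1) * Y ^ 2 := by nlinarith [mul_nonneg hX₀.le (sq_nonneg Y)]
  have hXsq : X ^ 2 ≤ 1 := by nlinarith
  have hconst : 2 * X ^ 2 * (2 * X - 1) * (X + 1) ≤ 4 := by
    have h : (2 * X - 1) * (X + 1) ≤ 2 := by nlinarith
    nlinarith [mul_le_mul_of_nonneg_left h (sq_nonneg X)]
  have hfactor : 1 ≤ 4 / X ^ 2 := by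
    rw [le_div_iff₀ (by positivity)]
    linarith
  exact one_le_mul_of_one_le_of_one_le hfactor (by nlinarith)

theorem coflow_no_unbounded_solution_eps_pos :
    ¬ ∃ X Y : ℝ → ℝ,
      Differentiable ℝ X ∧ Differentiable ℝ Y ∧
      (∀ s : ℝ, 0 ≤ s → deriv X s = coflowP 1 (X s) (Y s)) ∧
      (∀ s : ℝ, 0 ≤ s → deriv Y s = coflowQ 1 (X s) (Y s)) ∧
      (∀ s : ℝ, 0 ≤ s → 0 < X s ∧ X s < 1) ∧
      (∀ s : ℝ, 0 ≤ s → 0 < Y s) ∧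
      (∀ s : ℝ, 0 ≤ s → 0 < deriv Y s) ∧
      ¬ BddAbove (Y '' Set.Ici 0) := by
  rintro ⟨X, Y, hX, hY, hXP, -, hX01, -, hY', hunb⟩
  have hmono : MonotoneOn Y (Set.Ici 0) :=
    monotoneOn_of_deriv_nonneg (convex_Ici 0) hY.continuous.continuousOn
      hY.differentiableOn fun s hs => (hY' s (interior_subset hs)).le
  obtain ⟨_, ⟨a, ha, rfl⟩, hYa⟩ := not_bddAbove_iff.mp hunb 5
  rw [Set.mem_Ici] at ha
  have hgrow : ∀ s ∈ interior (Set.Ici a), 1 ≤ deriv X s := by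
    intro s hs
    have has : a ≤ s := interior_subset hs
    have hs₀ : 0 ≤ s := ha.trans has
    rw [hXP s hs₀]
    exact one_le_coflowP (hX01 s hs₀).1 (hX01 s hs₀).2 (hYa.le.trans (hmono ha hs₀ has))
  have hexit := (convex_Ici a).mul_sub_le_image_sub_of_le_deriv hX.continuous.continuousOn
    hX.differentiableOn hgrow a Set.self_mem_Ici (a + 1) (by simp) (by simp)
  linarith [(hX01 a ha).1, (hX01 (a + 1) (by linarith)).2]
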